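/- For w in the affine Weyl group W^aff, let ṽ_w be the unique element of the W-orbit of the translation vector v_w contained in the closed fundamental Weyl chamber. Then w is straight if and only if w admits a word expression in the Coxeter generators of length ⟨2ρ, ṽ_w⟩; in this case ℓ(w) = ⟨2ρ, ṽ_w⟩. -/

import Mathlib

open scoped RealInnerProductSpace

noncomputable section

/-- The ambient Euclidean space of rank `m`.  Via the fixed `W`-invariant inner product we
identify the space `V` containing the root system with its dual `V*`; the affine space `A`
underlying `V*` is then the Euclidean space itself. -/
abbrev E (m : ℕ) := EuclideanSpace ℝ (Fin m)

variable {m : ℕ}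

/-- The coroot `α∨ = 2α/(α,α)` of a vector `α` (under the identification of `V` with `V*`
given by the invariant inner product). -/
def coroot (α : E m) : E m := (2 / ⟪α, α⟫) • α

/-- The affine reflection `s_{α,k}(x) = x - (⟨α,x⟩ - k) α∨` as a function. -/
def affReflFun (α : E m) (k : ℤ) : E m → E m := fun x => x - (⟪α, x⟫ - (k : ℝ)) • coroot α

lemma affReflFun_involutive (α : E m) (k : ℤ) : Function.Involutive (affReflFun α k) := by
  intro x
  by_cases h : α = 0
  · simp [affReflFun, coroot, h]
  · have hαα : ⟪α, α⟫ ≠ (0:ℝ) := (inner_self_ne_zero (𝕜 := ℝ)).mpr h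
    have h2 : ⟪α, coroot α⟫ = (2:ℝ) := by
      unfold coroot
      rw [real_inner_smul_right, div_mul_cancel₀ _ hαα]
    have key : ∀ y : E m, ∀ s : ℝ, ⟪α, y - s • coroot α⟫ = ⟪α, y⟫ - 2 * s := by
      intro y s
      rw [inner_sub_right, real_inner_smul_right, h2]
      ring
    show affReflFun α k (x - (⟪α, x⟫ - (k:ℝ)) • coroot α) = x
    unfold affReflFun
    rw [key]
    rw [sub_sub, ← add_smul]
    rw [show (⟪α, x⟫ - (k:ℝ)) + (⟪α, x⟫ - 2 * (⟪α, x⟫ - (k:ℝ)) - (k:ℝ)) = 0 by ring]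
    simp

/-- The affine reflection `s_{α,k}` as a permutation of the affine space. -/
def affRefl (α : E m) (k : ℤ) : Equiv.Perm (E m) := (affReflFun_involutive α k).toPerm

/-- The affine Weyl group of a set of roots `Φ`: the group generated by all affine
reflections `s_{α,k}`, `α ∈ Φ`, `k ∈ ℤ`. -/
def Waff (Φ : Set (E m)) : Subgroup (Equiv.Perm (E m)) :=
  Subgroup.closure {w | ∃ α ∈ Φ, ∃ k : ℤ, w = affRefl α k}

/-- `Φ` is a reduced (crystallographic) root system spanning the ambient space. -/
structure IsRootSystem (Φ : Set (E m)) : Prop where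
  finite : Φ.Finite
  ne_zero : ∀ α ∈ Φ, α ≠ (0 : E m)
  span_eq_top : Submodule.span ℝ Φ = ⊤
  reflect_mem : ∀ α ∈ Φ, ∀ β ∈ Φ, β - ⟪α, β⟫ • coroot α ∈ Φ
  crystallographic : ∀ α ∈ Φ, ∀ β ∈ Φ, ∃ z : ℤ, ⟪α, coroot β⟫ = (z : ℝ)
  reduced : ∀ α ∈ Φ, ∀ t : ℝ, t • α ∈ Φ → t = 1 ∨ t = -1

/-- `B` is a system of simple roots of `Φ`. -/
structure IsSimpleSystem (Φ : Set (E m)) (B : Fin m → E m) : Prop where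
  mem : ∀ i, B i ∈ Φ
  indep : LinearIndependent ℝ B
  decomp : ∀ α ∈ Φ, (∃ c : Fin m → ℤ, α = ∑ j, (c j : ℝ) • B j ∧ ∀ j, 0 ≤ c j) ∨
                    (∃ c : Fin m → ℤ, α = ∑ j, (c j : ℝ) • B j ∧ ∀ j, c j ≤ 0)

/-- `ω` is the system of fundamental coweights relative to the simple roots `B`,
i.e. `⟨α_i, ω_j∨⟩ = δ_{ij}`. -/
def IsFundamentalCoweights (B ω : Fin m → E m) : Prop :=
  ∀ i j, ⟪B i, ω j⟫ = if i = j then (1 : ℝ) else 0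

/-- The wall `H_{α,k} = {x : ⟨α,x⟩ = k}`. -/
def wall (α : E m) (k : ℤ) : Set (E m) := {x | ⟪α, x⟫ = (k : ℝ)}

/-- The union of all walls of the root system `Φ`. -/
def allWalls (Φ : Set (E m)) : Set (E m) := ⋃ α ∈ Φ, ⋃ k : ℤ, wall α k

/-- An alcove: a connected component of the complement of the union of all walls. -/
def IsAlcove (Φ : Set (E m)) (C : Set (E m)) : Prop :=
  ∃ x ∈ (allWalls Φ)ᶜ, C = connectedComponentIn (allWalls Φ)ᶜ x

/-- The set `𝒲` of walls removed when forming geodesic tubes of direction `β∨`: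
all walls `H_{α,k}` with `⟨α, β∨⟩ = 0` (equivalently `α ∈ Φ_I`). -/
def tubeWalls (Φ : Set (E m)) (β : E m) : Set (E m) :=
  ⋃ α ∈ {α ∈ Φ | ⟪α, β⟫ = (0:ℝ)}, ⋃ k : ℤ, wall α k

/-- A geodesic tube of direction `β∨`: a connected component of `A ∖ ⋃𝒲`. -/
def IsGeodesicTube (Φ : Set (E m)) (β : E m) (T : Set (E m)) : Prop :=
  ∃ x ∈ (tubeWalls Φ β)ᶜ, T = connectedComponentIn (tubeWalls Φ β)ᶜ x

/-- `d_γ = inf_x d(x, γx)`. -/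
def minDisp (f : E m → E m) : ℝ := ⨅ x, dist x (f x)

/-- `Min(γ) = {x : d(x,γx) = d_γ}`. -/
def minSet (f : E m → E m) : Set (E m) := {x | dist x (f x) = minDisp f}

/-- A hyperbolic isometry: semisimple (`Min` nonempty) with `d_γ > 0`. -/
def IsHyperbolic (f : E m → E m) : Prop := (minSet f).Nonempty ∧ 0 < minDisp f

/-- `v` is the vector by which `γ` translates its min set. -/
def HasTransVec (f : E m → E m) (v : E m) : Prop := ∀ x ∈ minSet f, f x = x + v

/-- `x` is the barycenter of the polysimplex `s`: the average of the vertices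
(extreme points of the closure) of `s`. -/
def IsBarycenter (s : Set (E m)) (x : E m) : Prop :=
  ∃ F : Finset (E m), (F : Set (E m)) = Set.extremePoints ℝ (closure s) ∧ F.Nonempty ∧
    x = (F.card : ℝ)⁻¹ • ∑ y ∈ F, y

/-- The centerline `ℒ = x + ℝ β∨`. -/
def centerline (x β : E m) : Set (E m) := {p | ∃ t : ℝ, p = x + t • β}


/-- The finite Weyl group `W`, generated by the reflections `s_{α,0}`. -/
def W0 (Φ : Set (E m)) : Subgroup (Equiv.Perm (E m)) :=
  Subgroup.closure {w | ∃ α ∈ Φ, w = affRefl α 0}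

/-- `α̃` is the highest root of `Φ` relative to the simple system `B`. -/
def IsHighestRoot (Φ : Set (E m)) (B : Fin m → E m) (αh : E m) : Prop :=
  αh ∈ Φ ∧ ∀ α ∈ Φ, ∃ c : Fin m → ℝ, (∀ j, 0 ≤ c j) ∧ αh - α = ∑ j, c j • B j

/-- The standard Coxeter generating set `{s_0} ∪ S` of the affine Weyl group, where
`s_0 = s_{-α̃,1}` and `s_i = s_{α_i,0}`. -/
def SAff (B : Fin m → E m) (αh : E m) : Set (Equiv.Perm (E m)) :=
  {w | (∃ i, w = affRefl (B i) 0) ∨ w = affRefl (-αh) 1}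

/-- Word length with respect to a generating set `S` of a group. -/
def len {G : Type*} [Group G] (S : Set G) (w : G) : ℕ :=
  sInf {k | ∃ l : List G, (∀ g ∈ l, g ∈ S) ∧ l.length = k ∧ l.prod = w}

/-- A straight element: `ℓ(w^k) = k ℓ(w)` for all `k ∈ ℕ`. -/
def IsStraight {G : Type*} [Group G] (S : Set G) (w : G) : Prop :=
  ∀ k : ℕ, len S (w ^ k) = k * len S w

/-- `P` is the set of positive roots of `Φ` relative to `B`. -/
def IsPositiveSystem (Φ : Set (E m)) (B : Fin m → E m) (P : Finset (E m)) : Prop :=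
  (P : Set (E m)) = {α ∈ Φ | ∃ c : Fin m → ℝ, (∀ j, 0 ≤ c j) ∧ α = ∑ j, c j • B j}

/-! ### Abstract reflection combinatorics -/

section Abstract

variable {X : Type*}

/-- Affine roots negative at `x` and positive at `y`. -/
def sepSet (AR : (X → ℝ) → Equiv.Perm X → Prop) (x y : X) : Set (X → ℝ) :=
  {a | (∃ r, AR a r) ∧ a x < 0 ∧ 0 < a y}

/-- The abstract properties of a system of affine roots with base point `p`. -/
structure CoxData (AR : (X → ℝ) → Equiv.Perm X → Prop) (p : X) (S : Set (Equiv.Perm X)) :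
    Prop where
  conj : ∀ a r b s, AR a r → AR b s → AR (fun x => b (r x)) (r * s * r)
  neg : ∀ a r, AR a r → AR (fun x => - a x) r
  anti : ∀ a r, AR a r → ∀ x, a (r x) = - a x
  invol : ∀ a r, AR a r → r * r = 1
  uniq : ∀ a r r', AR a r → AR a r' → r = r'
  fin : ∀ x y, (sepSet AR x y).Finite
  off : ∀ a r, AR a r → a p ≠ 0
  perp : ∀ a r b s, AR a r → AR b s → (∀ x, b (r x) = - b x) → b = a ∨ b = fun x => - a x
  simple : ∀ s ∈ S, ∃ a, AR a s ∧ sepSet AR p (s p) = {a}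
  exists_simple : ∀ q, (∀ a r, AR a r → a q ≠ 0) → (sepSet AR p q).Nonempty →
    ∃ s ∈ S, ∃ a, AR a s ∧ sepSet AR p (s p) = {a} ∧ a ∈ sepSet AR p q

variable {AR : (X → ℝ) → Equiv.Perm X → Prop} {p : X} {S : Set (Equiv.Perm X)}

namespace CoxData

/-- The group generated by the reflections. -/
def grp (AR : (X → ℝ) → Equiv.Perm X → Prop) : Subgroup (Equiv.Perm X) :=
  Subgroup.closure {r | ∃ a, AR a r}

lemma inv_eq (h : CoxData AR p S) {a r} (har : AR a r) : r⁻¹ = r :=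
  inv_eq_of_mul_eq_one_left (h.invol a r har)

lemma app_app (h : CoxData AR p S) {a r} (har : AR a r) (x : X) : r (r x) = x := by
  have := congrArg (fun g : Equiv.Perm X => g x) (h.invol a r har)
  simpa using this

lemma comp_grp (h : CoxData AR p S) {w : Equiv.Perm X} (hw : w ∈ grp AR) :
    (∀ a, (∃ r, AR a r) → ∃ r, AR (fun x => a (w x)) r) := by
  unfold grp at hw
  induction hw using Subgroup.closure_induction'' with
  | one => intro a ha; simpa using ha
  | mem r hr =>
    rintro b ⟨s, hs⟩
    obtain ⟨a, ha⟩ := hr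
    exact ⟨_, h.conj a r b s ha hs⟩
  | inv_mem r hr =>
    rintro b ⟨s, hs⟩
    obtain ⟨a, ha⟩ := hr
    rw [h.inv_eq ha]
    exact ⟨_, h.conj a r b s ha hs⟩
  | mul u v _ _ hu hv =>
    intro a ha
    have := hv _ (hu a ha)
    simpa using this

lemma off_grp (h : CoxData AR p S) {w : Equiv.Perm X} (hw : w ∈ grp AR) {a r} (ha : AR a r) :
    a (w p) ≠ 0 := by
  obtain ⟨r', hr'⟩ := h.comp_grp hw a ⟨r, ha⟩
  exact h.off _ _ hr'

lemma ncard_sep_smul (h : CoxData AR p S) {w : Equiv.Perm X} (hw : w ∈ grp AR) (x y : X) :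
    (sepSet AR (w x) (w y)).ncard = (sepSet AR x y).ncard := by
  have hinj : Function.Injective (fun (a : X → ℝ) => fun x => a (w⁻¹ x)) := by
    intro a b hab
    funext z
    have := congrFun hab (w z)
    simpa using this
  rw [← Set.ncard_image_of_injective (sepSet AR x y) hinj]
  congr 1
  ext a
  constructor
  · rintro ⟨ha, h1, h2⟩
    refine ⟨fun x => a (w x), ⟨h.comp_grp hw a ha, h1, h2⟩, ?_⟩
    funext z
    simp
  · rintro ⟨b, ⟨hb, h1, h2⟩, rfl⟩
    refine ⟨h.comp_grp (inv_mem hw) b hb, ?_, ?_⟩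
    · simpa using h1
    · simpa using h2

lemma ncard_triangle (h : CoxData AR p S) (x y z : X) (hy : ∀ a r, AR a r → a y ≠ 0) :
    (sepSet AR x z).ncard ≤ (sepSet AR x y).ncard + (sepSet AR y z).ncard := by
  refine le_trans (Set.ncard_le_ncard ?_ ((h.fin x y).union (h.fin y z)))
    (Set.ncard_union_le _ _)
  rintro a ⟨⟨r, ha⟩, h1, h2⟩
  rcases lt_or_gt_of_ne (hy a r ha) with h3 | h3
  · exact Or.inr ⟨⟨r, ha⟩, h3, h2⟩
  · exact Or.inl ⟨⟨r, ha⟩, h1, h3⟩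

lemma S_mem (h : CoxData AR p S) {s} (hs : s ∈ S) : s ∈ grp AR := by
  obtain ⟨a, ha, _⟩ := h.simple s hs
  exact Subgroup.subset_closure ⟨a, ha⟩

lemma word_mem (h : CoxData AR p S) (l : List (Equiv.Perm X)) (hl : ∀ g ∈ l, g ∈ S) :
    l.prod ∈ grp AR :=
  Subgroup.list_prod_mem _ fun g hg => h.S_mem (hl g hg)

lemma sep_le_length (h : CoxData AR p S) (l : List (Equiv.Perm X)) (hl : ∀ g ∈ l, g ∈ S) :
    (sepSet AR p (l.prod p)).ncard ≤ l.length := by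
  induction l with
  | nil =>
    have : sepSet AR p (([] : List (Equiv.Perm X)).prod p) = ∅ := by
      ext a
      simp only [sepSet, List.prod_nil, Equiv.Perm.coe_one, id_eq, Set.mem_ofPred_eq,
        Set.mem_empty_iff_false, iff_false]
      rintro ⟨_, h1, h2⟩
      linarith
    rw [this]; simp
  | cons s l ih =>
    have hs : s ∈ S := hl s (by simp)
    have ih := ih fun g hg => hl g (by simp [hg])
    have h1 := h.ncard_triangle p (s p) ((s :: l).prod p)
      (fun a r ha => h.off_grp (h.S_mem hs) ha)
    obtain ⟨a, ha, hsep⟩ := h.simple s hs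
    have h2 := h.ncard_sep_smul (h.S_mem hs) p (l.prod p)
    rw [hsep, Set.ncard_singleton] at h1
    simp only [List.prod_cons, Equiv.Perm.coe_mul, Function.comp_apply, List.length_cons] at *
    omega

lemma exchange (h : CoxData AR p S) (l : List (Equiv.Perm X)) (hl : ∀ g ∈ l, g ∈ S) :
    ∀ a r, AR a r → a ∈ sepSet AR p (l.prod p) →
      ∃ l' : List (Equiv.Perm X), (∀ g ∈ l', g ∈ S) ∧ l'.length + 1 = l.length ∧
        l'.prod = r * l.prod := by
  induction l with
  | nil =>
    rintro a r ha ⟨_, h1, h2⟩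
    simp only [List.prod_nil, Equiv.Perm.coe_one, id_eq] at h2
    linarith
  | cons s l ih =>
    have hs : s ∈ S := hl s (by simp)
    have hl' : ∀ g ∈ l, g ∈ S := fun g hg => hl g (by simp [hg])
    have ih := ih hl'
    rintro a r ha ⟨_, h1, h2⟩
    obtain ⟨b, hb, hsep⟩ := h.simple s hs
    by_cases hab : a = b
    · subst hab
      have : r = s := h.uniq a r s ha hb
      subst this
      refine ⟨l, hl', by simp, ?_⟩
      rw [List.prod_cons, ← mul_assoc, h.invol a r ha, one_mul]
    · have h3 : a (s p) < 0 := by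
        rcases lt_or_gt_of_ne (h.off_grp (h.S_mem hs) ha) with h3 | h3
        · exact h3
        · exfalso
          apply hab
          have : a ∈ sepSet AR p (s p) := ⟨⟨r, ha⟩, h1, h3⟩
          rw [hsep] at this
          simpa using this
      obtain ⟨l', hm, hlen, hprod⟩ := ih _ _ (h.conj b s a r hb ha)
        ⟨⟨_, h.conj b s a r hb ha⟩, h3, by simpa using h2⟩
      refine ⟨s :: l', ?_, by simp [hlen], ?_⟩
      · intro g hg
        rcases List.mem_cons.1 hg with rfl | hg
        · exact hs
        · exact hm g hg
      · rw [List.prod_cons, List.prod_cons, hprod]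
        calc s * (s * r * s * l.prod) = (s * s) * r * s * l.prod := by simp only [mul_assoc]
          _ = _ := by rw [h.invol b s hb]; simp only [one_mul, mul_assoc]

lemma refl_mem_closure (h : CoxData AR p S) (n : ℕ) : ∀ a r, AR a r →
    (sepSet AR p (r p)).ncard = n → r ∈ Subgroup.closure S := by
  induction n using Nat.strong_induction_on with
  | _ n ih =>
  have main : ∀ a r, AR a r → a p < 0 →
    (sepSet AR p (r p)).ncard = n → r ∈ Subgroup.closure S := by
    intro a r ha hap hn
    have hrg : r ∈ grp AR := Subgroup.subset_closure ⟨a, ha⟩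
    have hmem : a ∈ sepSet AR p (r p) := ⟨⟨r, ha⟩, hap, by rw [h.anti a r ha]; linarith⟩
    obtain ⟨s, hs, b, hb, hsep, hbm⟩ := h.exists_simple (r p)
      (fun _ _ hc => h.off_grp hrg hc) ⟨a, hmem⟩
    have hsg := h.S_mem hs
    by_cases hab : b = a
    · subst hab
      rw [h.uniq b r s ha hb]
      exact Subgroup.subset_closure hs
    · have hsingle : ∀ c, (∃ t, AR c t) → c p < 0 → 0 < c (s p) → c = b := by
        intro c hc h1 h2
        have : c ∈ sepSet AR p (s p) := ⟨hc, h1, h2⟩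
        rw [hsep] at this
        simpa using this
      have hbp : b p < 0 := hbm.2.1
      have hbrp : 0 < b (r p) := hbm.2.2
      have hbsp : 0 < b (s p) := by rw [h.anti b s hb]; linarith
      have hlt : (sepSet AR p ((s * r * s) p)).ncard < n := by
        have h1 : (sepSet AR p ((s * r * s) p)).ncard =
            (sepSet AR (s p) (r (s p))).ncard := by
          rw [← h.ncard_sep_smul hsg (s p) (r (s p)), h.app_app hb]
          rfl
        rw [h1, ← hn]
        apply Set.ncard_lt_ncard _ (h.fin _ _)
        refine ⟨?_, fun hsub => ?_⟩
        · rintro c ⟨⟨t, hc⟩, h2, h3⟩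
          have hcp : c p < 0 := by
            rcases lt_or_gt_of_ne (h.off c t hc) with h4 | h4
            · exact h4
            · exfalso
              have h5 := hsingle _ ⟨t, h.neg c t hc⟩ (by simpa using h4) (by simpa using h2)
              have h6 : ∀ x, c x = - b x := fun x => by rw [← h5]; simp
              have h7 : b (r (s p)) < 0 := by
                have := h6 (r (s p)); linarith
              have h8 := hsingle _ ⟨_, h.neg _ _ (h.conj a r b s ha hb)⟩
                (by simpa using hbrp) (by simpa using h7)
              have h9 : ∀ x, b (r x) = - b x := by
                intro x
                have := congrFun h8 x
                linarith
              rcases h.perp a r b s ha hb h9 with h10 | h10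
              · exact hab h10
              · have := congrFun h10 p
                linarith
          refine ⟨⟨t, hc⟩, hcp, ?_⟩
          rcases lt_or_gt_of_ne (h.off_grp hrg hc) with h4 | h4
          · exfalso
            have h5 := hsingle _ ⟨_, h.conj a r c t ha hc⟩ h4 h3
            have h6 := congrFun h5 (r p)
            simp only [h.app_app ha] at h6
            linarith
          · exact h4
        · have := (hsub hbm).2.1
          linarith
      have := ih _ hlt _ _ (h.conj b s a r hb ha) rfl
      have hsc : s ∈ Subgroup.closure S := Subgroup.subset_closure hs
      have h2 := mul_mem (mul_mem hsc this) hsc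
      have h3 : s * (s * r * s) * s = r := by
        calc s * (s * r * s) * s = (s * s) * r * (s * s) := by simp only [mul_assoc]
          _ = r := by rw [h.invol b s hb]; simp
      rwa [h3] at h2
  intro a r ha hn
  rcases lt_or_gt_of_ne (h.off a r ha) with h4 | h4
  · exact main a r ha h4 hn
  · exact main _ r (h.neg a r ha) (by simpa using h4) hn

lemma exists_word (h : CoxData AR p S) {w} (hw : w ∈ grp AR) :
    ∃ l : List (Equiv.Perm X), (∀ g ∈ l, g ∈ S) ∧ l.prod = w := by
  have h1 : w ∈ Subgroup.closure S := by
    refine (Subgroup.closure_le _).2 ?_ hw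
    rintro r ⟨a, ha⟩
    exact h.refl_mem_closure _ a r ha rfl
  rw [← Subgroup.mem_toSubmonoid, Subgroup.closure_toSubmonoid] at h1
  obtain ⟨l, hl, hp⟩ := Submonoid.exists_list_of_mem_closure h1
  refine ⟨l, fun g hg => ?_, hp⟩
  rcases hl g hg with h2 | h2
  · exact h2
  · obtain ⟨a, ha, _⟩ := h.simple _ (Set.mem_inv.1 h2)
    have := h.inv_eq ha
    rw [inv_inv] at this
    rw [this]
    exact Set.mem_inv.1 h2

lemma len_le (l : List (Equiv.Perm X)) (hl : ∀ g ∈ l, g ∈ S) : len S l.prod ≤ l.length :=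
  Nat.sInf_le ⟨l, hl, rfl, rfl⟩

lemma exists_min_word (h : CoxData AR p S) {w} (hw : w ∈ grp AR) :
    ∃ l : List (Equiv.Perm X), (∀ g ∈ l, g ∈ S) ∧ l.length = len S w ∧ l.prod = w := by
  obtain ⟨l, hl, hp⟩ := h.exists_word hw
  exact Nat.sInf_mem (s := {k | ∃ l : List (Equiv.Perm X), (∀ g ∈ l, g ∈ S) ∧ l.length = k ∧
    l.prod = w}) ⟨_, l, hl, rfl, hp⟩

lemma eq_one (h : CoxData AR p S) {w} (hw : w ∈ grp AR) (h0 : sepSet AR p (w p) = ∅) :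
    w = 1 := by
  obtain ⟨l, hl, hlen, hp⟩ := h.exists_min_word hw
  cases l with
  | nil => simpa using hp.symm
  | cons s l =>
    exfalso
    have hs : s ∈ S := hl s (by simp)
    have hl' : ∀ g ∈ l, g ∈ S := fun g hg => hl g (by simp [hg])
    obtain ⟨a, ha, hsep⟩ := h.simple s hs
    have h1 : a ∈ sepSet AR p (s p) := by rw [hsep]; simp
    have h2 : a (w p) < 0 := by
      rcases lt_or_gt_of_ne (h.off_grp hw ha) with h3 | h3
      · exact h3
      · have : a ∈ sepSet AR p (w p) := ⟨⟨s, ha⟩, h1.2.1, h3⟩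
        rw [h0] at this
        exact this.elim
    have h3 : 0 < a (l.prod p) := by
      rw [← hp, List.prod_cons, Equiv.Perm.mul_apply, h.anti a s ha] at h2
      linarith
    obtain ⟨l', hm, hlen', hprod⟩ := h.exchange l hl' a s ha ⟨⟨s, ha⟩, h1.2.1, h3⟩
    have h4 := len_le l' hm
    rw [hprod, ← List.prod_cons, hp, ← hlen] at h4
    simp only [List.length_cons] at h4
    omega

lemma exists_short_word (h : CoxData AR p S) (n : ℕ) : ∀ w ∈ grp AR,
    (sepSet AR p (w p)).ncard = n →
    ∃ l : List (Equiv.Perm X), (∀ g ∈ l, g ∈ S) ∧ l.length ≤ n ∧ l.prod = w := by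
  induction n using Nat.strong_induction_on with
  | _ n ih =>
  intro w hw hn
  rcases Set.eq_empty_or_nonempty (sepSet AR p (w p)) with h0 | h0
  · exact ⟨[], by simp, by simp, by simp [h.eq_one hw h0]⟩
  · obtain ⟨s, hs, b, hb, hsep, hbm⟩ := h.exists_simple (w p)
      (fun _ _ hc => h.off_grp hw hc) h0
    have hsg := h.S_mem hs
    have hlt : (sepSet AR p ((s * w) p)).ncard < n := by
      have h1 : (sepSet AR p ((s * w) p)).ncard = (sepSet AR (s p) (w p)).ncard := by
        rw [← h.ncard_sep_smul hsg (s p) (w p), h.app_app hb]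
        rfl
      rw [h1, ← hn]
      apply Set.ncard_lt_ncard _ (h.fin _ _)
      refine ⟨?_, fun hsub => ?_⟩
      · rintro c ⟨⟨t, hc⟩, h2, h3⟩
        refine ⟨⟨t, hc⟩, ?_, h3⟩
        rcases lt_or_gt_of_ne (h.off c t hc) with h4 | h4
        · exact h4
        · exfalso
          have : (fun x => - c x) ∈ sepSet AR p (s p) :=
            ⟨⟨t, h.neg c t hc⟩, by simpa using h4, by simpa using h2⟩
          rw [hsep] at this
          have h5 : (fun x => - c x) = b := by simpa using this
          have h6 := congrFun h5 (w p)
          have := hbm.2.2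
          linarith
      · have h2 := (hsub hbm).2.1
        rw [h.anti b s hb] at h2
        have := hbm.2.1
        linarith
    obtain ⟨l, hl, hlen, hp⟩ := ih _ hlt _ (mul_mem hsg hw) rfl
    refine ⟨s :: l, ?_, ?_, ?_⟩
    · intro g hg
      rcases List.mem_cons.1 hg with rfl | hg
      · exact hs
      · exact hl g hg
    · simp only [List.length_cons]; omega
    · rw [List.prod_cons, hp, ← mul_assoc, h.invol b s hb, one_mul]

lemma len_eq (h : CoxData AR p S) {w} (hw : w ∈ grp AR) :
    len S w = (sepSet AR p (w p)).ncard := by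
  apply le_antisymm
  · obtain ⟨l, hl, hlen, hp⟩ := h.exists_short_word _ w hw rfl
    rw [← hp] at hlen ⊢
    exact (len_le l hl).trans hlen
  · obtain ⟨l, hl, hlen, hp⟩ := h.exists_min_word hw
    rw [← hlen, ← hp]
    exact h.sep_le_length l hl

lemma len_pow_le (h : CoxData AR p S) {w} (hw : w ∈ grp AR) (n : ℕ) :
    len S (w ^ n) ≤ n * len S w := by
  obtain ⟨l, hl, hlen, hp⟩ := h.exists_min_word hw
  have h1 : ((List.replicate n l).flatten).prod = w ^ n := by
    simp [List.prod_flatten, hp]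
  rw [← h1]
  refine (len_le _ ?_).trans ?_
  · intro g hg
    simp only [List.mem_flatten, List.mem_replicate] at hg
    obtain ⟨_, ⟨_, rfl⟩, hg⟩ := hg
    exact hl g hg
  · simp [List.length_flatten, hlen]

/-- The straightness criterion, given the length of a power. -/
lemma straight_iff (h : CoxData AR p S) {w} (hw : w ∈ grp AR) (L : ℝ) (k : ℕ) (hk : 0 < k)
    (hL : ∀ n : ℕ, (len S (w ^ (k * n)) : ℝ) = k * n * L) :
    (IsStraight S w ↔ ∃ l : List (Equiv.Perm X), (∀ g ∈ l, g ∈ S) ∧ l.prod = w ∧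
        (l.length : ℝ) = L) ∧ (IsStraight S w → (len S w : ℝ) = L) := by
  have hk' : (0 : ℝ) < k := by exact_mod_cast hk
  have hst : IsStraight S w → (len S w : ℝ) = L := by
    intro hs
    have h1 := hL 1
    rw [hs] at h1
    push_cast at h1
    have : (k : ℝ) * (len S w - L) = 0 := by linarith
    rcases mul_eq_zero.1 this with h2 | h2 <;> linarith
  refine ⟨⟨fun hs => ?_, ?_⟩, hst⟩
  · obtain ⟨l, hl, hlen, hp⟩ := h.exists_min_word hw
    exact ⟨l, hl, hp, by rw [hlen]; exact hst hs⟩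
  · rintro ⟨l, hl, hp, hlen⟩
    have h1 : (len S w : ℝ) ≤ L := by
      rw [← hlen, ← hp]
      exact_mod_cast len_le l hl
    have hge : ∀ n : ℕ, n * L ≤ len S (w ^ n) := by
      intro n
      have h2 := h.len_pow_le (pow_mem hw n) k
      rw [← pow_mul, mul_comm n k] at h2
      have h3 : (len S (w ^ (k * n)) : ℝ) ≤ k * len S (w ^ n) := by exact_mod_cast h2
      rw [hL, mul_assoc] at h3
      exact le_of_mul_le_mul_left h3 hk'
    have h4 : (len S w : ℝ) = L := by
      apply le_antisymm h1
      have := hge 1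
      simpa using this
    intro n
    apply le_antisymm (h.len_pow_le hw n)
    have := hge n
    rw [← h4] at this
    exact_mod_cast this

end CoxData

end Abstract

/-! ### The concrete affine root system -/

/-- `a` is the affine root `⟨α, ·⟩ - k` and `r` the corresponding reflection. -/
def affAR (Φ : Set (E m)) (a : E m → ℝ) (r : Equiv.Perm (E m)) : Prop :=
  ∃ α ∈ Φ, ∃ k : ℤ, a = (fun x => ⟪α, x⟫ - (k : ℝ)) ∧ r = affRefl α k

lemma affRefl_apply (α : E m) (k : ℤ) (x : E m) :
    affRefl α k x = x - (⟪α, x⟫ - (k : ℝ)) • coroot α := rfl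

lemma inner_coroot_self {α : E m} (h : α ≠ 0) : ⟪α, coroot α⟫ = (2 : ℝ) := by
  have hαα : ⟪α, α⟫ ≠ (0:ℝ) := (inner_self_ne_zero (𝕜 := ℝ)).mpr h
  unfold coroot
  rw [real_inner_smul_right, div_mul_cancel₀ _ hαα]

lemma inner_refl (α β x : E m) :
    ⟪β - ⟪α, β⟫ • coroot α, x⟫ = ⟪β, x⟫ - ⟪α, x⟫ * ⟪β, coroot α⟫ := by
  unfold coroot
  simp only [inner_sub_left, real_inner_smul_left, real_inner_smul_right, real_inner_comm α β]
  ring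

lemma inner_refl' (α β x : E m) :
    ⟪β - ⟪α, β⟫ • coroot α, x⟫ = ⟪β, x - ⟪α, x⟫ • coroot α⟫ := by
  rw [inner_refl, inner_sub_right, real_inner_smul_right]

lemma inner_refl_self {α : E m} (x y : E m) :
    ⟪x - ⟪α, x⟫ • coroot α, y - ⟪α, y⟫ • coroot α⟫ = ⟪x, y⟫ := by
  rw [inner_refl']
  congr 1
  have := affReflFun_involutive α 0 y
  simpa [affReflFun] using this

lemma coroot_refl {α : E m} (β : E m) :
    coroot (β - ⟪α, β⟫ • coroot α) = coroot β - ⟪α, coroot β⟫ • coroot α := by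
  have h1 : coroot (β - ⟪α, β⟫ • coroot α) =
      (2 / ⟪β - ⟪α, β⟫ • coroot α, β - ⟪α, β⟫ • coroot α⟫) • (β - ⟪α, β⟫ • coroot α) := rfl
  rw [h1, inner_refl_self]
  conv_rhs => rw [show coroot β = (2 / ⟪β, β⟫) • β from rfl]
  rw [real_inner_smul_right, smul_sub, smul_smul]

lemma IsRootSystem.neg_mem {Φ : Set (E m)} (hΦ : IsRootSystem Φ) {α : E m} (h : α ∈ Φ) :
    -α ∈ Φ := by
  have h1 := hΦ.reflect_mem α h α h
  have h2 : α - ⟪α, α⟫ • coroot α = -α := by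
    have hαα : ⟪α, α⟫ ≠ (0:ℝ) := (inner_self_ne_zero (𝕜 := ℝ)).mpr (hΦ.ne_zero α h)
    unfold coroot
    rw [smul_smul, mul_div_cancel₀ _ hαα, two_smul]
    abel
  rwa [h2] at h1

lemma coroot_neg (α : E m) : coroot (-α) = - coroot α := by
  simp [coroot]

lemma affRefl_neg (α : E m) (k : ℤ) : affRefl (-α) (-k) = affRefl α k := by
  ext1 x
  rw [affRefl_apply, affRefl_apply, coroot_neg, inner_neg_left]
  push_cast
  rw [smul_neg, ← neg_smul]
  congr 2
  ring

lemma affAR_neg {Φ : Set (E m)} (hΦ : IsRootSystem Φ) (a r) (h : affAR Φ a r) :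
    affAR Φ (fun x => - a x) r := by
  obtain ⟨α, hα, k, rfl, rfl⟩ := h
  refine ⟨-α, hΦ.neg_mem hα, -k, ?_, (affRefl_neg α k).symm⟩
  funext x
  rw [inner_neg_left]
  push_cast
  ring

lemma affAR_anti {Φ : Set (E m)} (hΦ : IsRootSystem Φ) (a r) (h : affAR Φ a r) (x : E m) :
    a (r x) = - a x := by
  obtain ⟨α, hα, k, rfl, rfl⟩ := h
  simp only [affRefl_apply]
  rw [inner_sub_right, real_inner_smul_right, inner_coroot_self (hΦ.ne_zero α hα)]
  ring

lemma affAR_invol {Φ : Set (E m)} (a r) (h : affAR Φ a r) : r * r = 1 := by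
  obtain ⟨α, hα, k, rfl, rfl⟩ := h
  ext1 x
  exact affReflFun_involutive α k x

lemma affAR_conj {Φ : Set (E m)} (hΦ : IsRootSystem Φ) (a r b s) (h : affAR Φ a r)
    (h' : affAR Φ b s) : affAR Φ (fun x => b (r x)) (r * s * r) := by
  obtain ⟨α, hα, k, rfl, rfl⟩ := h
  obtain ⟨β, hβ, j, rfl, rfl⟩ := h'
  obtain ⟨n, hn⟩ := hΦ.crystallographic β hβ α hα
  have key : ∀ x, ⟪β, affRefl α k x⟫ - (j : ℝ) =
      ⟪β - ⟪α, β⟫ • coroot α, x⟫ - ((j - k * n : ℤ) : ℝ) := by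
    intro x
    rw [affRefl_apply, inner_sub_right, real_inner_smul_right, inner_refl, hn]
    push_cast
    ring
  refine ⟨β - ⟪α, β⟫ • coroot α, hΦ.reflect_mem α hα β hβ, j - k * n, funext key, ?_⟩
  ext1 x
  have hxx : affRefl α k (affRefl α k x) = x := affReflFun_involutive α k x
  show affRefl α k (affRefl β j (affRefl α k x)) = _
  rw [affRefl_apply β j, affRefl_apply (β - _), ← key, coroot_refl]
  have lin : ∀ y (c : ℝ), affRefl α k (y - c • coroot β) =
      affRefl α k y - c • (coroot β - ⟪α, coroot β⟫ • coroot α) := by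
    intro y c
    simp only [affRefl_apply, inner_sub_right, real_inner_smul_right]
    module
  rw [lin, hxx]

lemma aff_inj {α β : E m} {k j : ℤ}
    (h : (fun x : E m => ⟪α, x⟫ - (k : ℝ)) = fun x => ⟪β, x⟫ - (j : ℝ)) : α = β ∧ k = j := by
  have h0 := congrFun h 0
  simp only [inner_zero_right, zero_sub, neg_inj, Int.cast_inj] at h0
  refine ⟨?_, h0⟩
  apply ext_inner_right ℝ
  intro x
  have := congrFun h x
  simp only [h0] at this
  linarith

lemma affAR_uniq {Φ : Set (E m)} (a r r') (h : affAR Φ a r) (h' : affAR Φ a r') : r = r' := by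
  obtain ⟨α, hα, k, rfl, rfl⟩ := h
  obtain ⟨β, hβ, j, hab, rfl⟩ := h'
  obtain ⟨rfl, rfl⟩ := aff_inj hab
  rfl

lemma affAR_perp {Φ : Set (E m)} (hΦ : IsRootSystem Φ) (a r b s) (h : affAR Φ a r)
    (h' : affAR Φ b s) (hp : ∀ x, b (r x) = - b x) : b = a ∨ b = fun x => - a x := by
  obtain ⟨α, hα, k, rfl, rfl⟩ := h
  obtain ⟨β, hβ, j, rfl, rfl⟩ := h'
  set t : ℝ := ⟪β, coroot α⟫ / 2 with ht
  have key : ∀ x, ⟪β, x⟫ - (j : ℝ) = t * (⟪α, x⟫ - k) := by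
    intro x
    have := hp x
    simp only [affRefl_apply, inner_sub_right, real_inner_smul_right] at this
    rw [ht]
    linarith
  have h0 := key 0
  simp only [inner_zero_right] at h0
  have hβt : t • α = β := by
    apply ext_inner_right ℝ
    intro x
    rw [real_inner_smul_left]
    have := key x
    linarith
  rcases hΦ.reduced α hα t (hβt ▸ hβ) with h1 | h1
  · left
    funext x
    rw [key, h1, one_mul]
  · right
    funext x
    rw [key, h1]
    ring

lemma affAR_fin {Φ : Set (E m)} (hΦ : IsRootSystem Φ) (x y : E m) :
    (sepSet (affAR Φ) x y).Finite := by
  have hf : (⋃ α ∈ Φ, (fun k : ℤ => fun z : E m => ⟪α, z⟫ - (k : ℝ)) ''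
      (Set.Icc ⌊⟪α, x⟫⌋ ⌈⟪α, y⟫⌉)).Finite :=
    hΦ.finite.biUnion fun α _ => (Set.finite_Icc _ _).image _
  refine hf.subset ?_
  rintro a ⟨⟨r, α, hα, k, rfl, rfl⟩, h1, h2⟩
  simp only [Set.mem_iUnion]
  refine ⟨α, hα, k, ⟨?_, ?_⟩, rfl⟩
  · rw [← Int.cast_le (R := ℝ)]
    have := Int.floor_le (⟪α, x⟫ : ℝ)
    linarith
  · rw [← Int.cast_le (R := ℝ)]
    have := Int.le_ceil (⟪α, y⟫ : ℝ)
    linarith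

/-! ### Positivity and the fundamental alcove -/

/-- nonnegative combination of simple roots -/
def isPos (B : Fin m → E m) (α : E m) : Prop :=
  ∃ c : Fin m → ℝ, (∀ j, 0 ≤ c j) ∧ α = ∑ j, c j • B j

lemma inner_comb (B : Fin m → E m) (c : Fin m → ℝ) (x : E m) :
    ⟪∑ j, c j • B j, x⟫ = ∑ j, c j * ⟪B j, x⟫ := by
  rw [sum_inner]
  simp only [real_inner_smul_left]

lemma isPos_or {Φ : Set (E m)} {B : Fin m → E m} (hB : IsSimpleSystem Φ B) {α : E m}
    (hα : α ∈ Φ) : isPos B α ∨ isPos B (-α) := by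
  rcases hB.decomp α hα with ⟨c, h1, h2⟩ | ⟨c, h1, h2⟩
  · exact Or.inl ⟨fun j => c j, fun j => Int.cast_nonneg (h2 j), h1⟩
  · refine Or.inr ⟨fun j => -(c j : ℝ), fun j => ?_, ?_⟩
    · have : (c j : ℝ) ≤ 0 := by exact_mod_cast h2 j
      linarith
    · rw [h1, ← Finset.sum_neg_distrib]
      simp

lemma isPos.inner_nonpos {B : Fin m → E m} {α x : E m} (h : isPos B α)
    (hx : ∀ j, ⟪B j, x⟫ ≤ (0 : ℝ)) : ⟪α, x⟫ ≤ (0 : ℝ) := by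
  obtain ⟨c, hc, rfl⟩ := h
  rw [inner_comb]
  exact Finset.sum_nonpos fun j _ => mul_nonpos_of_nonneg_of_nonpos (hc j) (hx j)

lemma isPos.inner_neg {B : Fin m → E m} {α x : E m} (h : isPos B α) (h0 : α ≠ 0)
    (hx : ∀ j, ⟪B j, x⟫ < (0 : ℝ)) : ⟪α, x⟫ < (0 : ℝ) := by
  obtain ⟨c, hc, rfl⟩ := h
  rw [inner_comb]
  apply Finset.sum_neg' (fun j _ => mul_nonpos_of_nonneg_of_nonpos (hc j) (hx j).le)
  by_contra hcon
  push Not at hcon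
  apply h0
  apply Finset.sum_eq_zero
  intro j hj
  have h1 := hcon j hj
  have : c j = 0 := by
    by_contra h2
    have : 0 < c j := lt_of_le_of_ne (hc j) (Ne.symm h2)
    have := mul_neg_of_pos_of_neg this (hx j)
    linarith
  rw [this, zero_smul]

lemma exists_dual {Φ : Set (E m)} {B : Fin m → E m} (hB : IsSimpleSystem Φ B) (c : Fin m → ℝ) :
    ∃ x : E m, ∀ j, ⟪B j, x⟫ = c j := by
  rcases Nat.eq_zero_or_pos m with rfl | hm
  · exact ⟨0, fun j => j.elim0⟩
  have : Nonempty (Fin m) := ⟨⟨0, hm⟩⟩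
  let b := basisOfLinearIndependentOfCardEqFinrank hB.indep (by simp)
  let f : E m →ₗ[ℝ] ℝ := b.constr ℝ c
  refine ⟨(InnerProductSpace.toDual ℝ (E m)).symm (LinearMap.toContinuousLinearMap f),
    fun j => ?_⟩
  rw [real_inner_comm, InnerProductSpace.toDual_symm_apply]
  have : b j = B j := by simp [b]
  rw [← this]
  simp [f]

/-- The closed fundamental alcove. -/
structure inAlc (B : Fin m → E m) (αh : E m) (x : E m) : Prop where
  le : ∀ j, ⟪B j, x⟫ ≤ (0 : ℝ)
  ge : (-1 : ℝ) ≤ ⟪αh, x⟫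

/-- The open fundamental alcove. -/
structure inAlcO (B : Fin m → E m) (αh : E m) (x : E m) : Prop where
  lt : ∀ j, ⟪B j, x⟫ < (0 : ℝ)
  gt : (-1 : ℝ) < ⟪αh, x⟫

lemma highest_pos {Φ : Set (E m)} (hΦ : IsRootSystem Φ) {B : Fin m → E m}
    {αh : E m} (h : IsHighestRoot Φ B αh) : isPos B αh := by
  obtain ⟨c, hc, he⟩ := h.2 _ (hΦ.neg_mem h.1)
  refine ⟨fun j => c j / 2, fun j => by have := hc j; positivity, ?_⟩
  have h1 : (2 : ℝ) • αh = ∑ j, c j • B j := by rw [← he, two_smul]; abel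
  have h2 : αh = (2⁻¹ : ℝ) • ∑ j, c j • B j := by rw [← h1, smul_smul]; norm_num
  rw [h2, Finset.smul_sum]
  apply Finset.sum_congr rfl
  intro j _
  rw [smul_smul]
  congr 1
  ring

lemma highest_le {Φ : Set (E m)} {B : Fin m → E m}
    {αh : E m} (h : IsHighestRoot Φ B αh) {β x : E m} (hβ : β ∈ Φ)
    (hx : ∀ j, ⟪B j, x⟫ ≤ (0 : ℝ)) : (⟪αh, x⟫ : ℝ) ≤ ⟪β, x⟫ := by
  have h1 : isPos B (αh - β) := h.2 β hβ
  have := h1.inner_nonpos hx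
  rw [inner_sub_left] at this
  linarith

/-- An affine root negative in the open alcove is nonpositive on the closed alcove. -/
lemma alc_nonpos {Φ : Set (E m)} (hΦ : IsRootSystem Φ) {B : Fin m → E m}
    (hB : IsSimpleSystem Φ B) {αh : E m} (h : IsHighestRoot Φ B αh) {p y : E m}
    (hp : inAlcO B αh p) (hy : inAlc B αh y) {b r} (hb : affAR Φ b r) (hbp : b p < 0) :
    b y ≤ 0 := by
  obtain ⟨β, hβ, k, rfl, rfl⟩ := hb
  simp only at hbp ⊢
  rcases isPos_or hB hβ with h1 | h1
  · have h2 := h1.inner_nonpos hy.le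
    have h3 := highest_le h hβ (fun j => (hp.lt j).le)
    have h4 := hp.gt
    have h5 : (-1 : ℝ) < k := by linarith
    have h6 : (-1 : ℤ) < k := by exact_mod_cast h5
    have h7 : (0 : ℤ) ≤ k := by omega
    have h8 : (0 : ℝ) ≤ k := by exact_mod_cast h7
    linarith
  · have h2 := h1.inner_nonpos (fun j => (hp.lt j).le)
    have h3 := highest_le h (hΦ.neg_mem hβ) hy.le
    rw [inner_neg_left] at h2 h3
    have h4 := hy.ge
    have h5 : (0 : ℝ) < k := by linarith
    have h6 : (0 : ℤ) < k := by exact_mod_cast h5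
    have h7 : (1 : ℤ) ≤ k := by omega
    have h8 : (1 : ℝ) ≤ k := by exact_mod_cast h7
    linarith

lemma alc_off {Φ : Set (E m)} (hΦ : IsRootSystem Φ) {B : Fin m → E m}
    (hB : IsSimpleSystem Φ B) {αh : E m} (h : IsHighestRoot Φ B αh) {p : E m}
    (hp : inAlcO B αh p) (b r) (hb : affAR Φ b r) : b p ≠ 0 := by
  have key : ∀ β ∈ Φ, isPos B β → ∀ k : ℤ, ⟪β, p⟫ ≠ (k : ℝ) := by
    intro β hβ h1 k hk
    have h2 := h1.inner_neg (hΦ.ne_zero β hβ) hp.lt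
    have h3 := highest_le h hβ (fun j => (hp.lt j).le)
    have h4 := hp.gt
    rw [hk] at h2 h3
    have h5 : (-1 : ℝ) < k := by linarith
    have h6 : (-1 : ℤ) < k := by exact_mod_cast h5
    have h7 : k < 0 := by exact_mod_cast h2
    omega
  obtain ⟨β, hβ, k, rfl, rfl⟩ := hb
  intro h0
  simp only at h0
  rcases isPos_or hB hβ with h1 | h1
  · exact key β hβ h1 k (by linarith)
  · apply key _ (hΦ.neg_mem hβ) h1 (-k)
    rw [inner_neg_left]
    push_cast
    linarith

/-- Simple walls: criterion for a reflection to cross exactly one wall. -/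
lemma sep_simple {Φ : Set (E m)} (hΦ : IsRootSystem Φ) {B : Fin m → E m}
    (hB : IsSimpleSystem Φ B) {αh : E m} (h : IsHighestRoot Φ B αh) {p y : E m}
    (hp : inAlcO B αh p) (hy : inAlc B αh y) {a s} (ha : affAR Φ a s) (hap : a p < 0)
    (hsy : s y = y)
    (huniq : ∀ β ∈ Φ, isPos B β → ∀ k : ℤ, ⟪β, y⟫ = (k : ℝ) →
      (fun x : E m => ⟪β, x⟫ - (k : ℝ)) = a ∨ (fun x : E m => ⟪β, x⟫ - (k : ℝ)) = fun x => - a x) :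
    sepSet (affAR Φ) p (s p) = {a} := by
  ext b
  constructor
  · rintro ⟨⟨r, hb⟩, h1, h2⟩
    have h3 := alc_nonpos hΦ hB h hp hy hb h1
    have h4 := alc_nonpos hΦ hB h hp hy (affAR_neg hΦ _ _ (affAR_conj hΦ a s b r ha hb))
      (by simpa using h2)
    rw [hsy] at h4
    have h5 : b y = 0 := by linarith
    obtain ⟨β, hβ, k, rfl, rfl⟩ := hb
    simp only at h5 h1
    have h6 : (fun x : E m => ⟪β, x⟫ - (k : ℝ)) = a ∨
        (fun x : E m => ⟪β, x⟫ - (k : ℝ)) = fun x => - a x := by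
      rcases isPos_or hB hβ with h6 | h6
      · exact huniq β hβ h6 k (by linarith)
      · rcases huniq _ (hΦ.neg_mem hβ) h6 (-k)
          (by rw [inner_neg_left]; push_cast; linarith) with h7 | h7
        · right
          funext x
          have := congrFun h7 x
          rw [inner_neg_left] at this
          push_cast at this
          linarith
        · left
          funext x
          have := congrFun h7 x
          rw [inner_neg_left] at this
          push_cast at this
          linarith
    rcases h6 with h6 | h6
    · exact h6
    · exfalso
      have := congrFun h6 p
      linarith
  · intro hb
    have hb : b = a := hb
    subst hb
    exact ⟨⟨s, ha⟩, hap, by rw [affAR_anti hΦ b s ha]; linarith⟩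

/-- There is a base point making everything a `CoxData`. -/
lemma exists_coxData {Φ : Set (E m)} (hΦ : IsRootSystem Φ) {B : Fin m → E m}
    (hB : IsSimpleSystem Φ B) {αh : E m} (h : IsHighestRoot Φ B αh) :
    ∃ p : E m, CoxData (affAR Φ) p (SAff B αh) := by
  obtain ⟨x0, hx0⟩ := exists_dual hB (fun _ => (-1 : ℝ))
  have hneg : ⟪αh, x0⟫ < (0 : ℝ) := (highest_pos hΦ h).inner_neg (hΦ.ne_zero _ h.1)
    (fun j => by rw [hx0]; norm_num)
  set H : ℝ := -⟪αh, x0⟫ with hH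
  have hHpos : 0 < H := by linarith
  set ε : ℝ := 1 / (H + 1) with hε
  have hεpos : 0 < ε := by positivity
  have hεH : ε * H < 1 := by
    rw [hε, one_div, inv_mul_lt_iff₀ (by positivity)]
    linarith
  have hp : inAlcO B αh (ε • x0) := by
    constructor
    · intro j
      rw [real_inner_smul_right, hx0]
      linarith
    · rw [real_inner_smul_right]
      nlinarith
  set p := ε • x0 with hpdef
  have simpleB : ∀ i, affAR Φ (fun x => ⟪B i, x⟫ - ((0 : ℤ) : ℝ)) (affRefl (B i) 0) ∧
      sepSet (affAR Φ) p (affRefl (B i) 0 p) = {fun x => ⟪B i, x⟫ - ((0 : ℤ) : ℝ)} := by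
    intro i
    have hAR : affAR Φ (fun x => ⟪B i, x⟫ - ((0 : ℤ) : ℝ)) (affRefl (B i) 0) :=
      ⟨B i, hB.mem i, 0, rfl, rfl⟩
    refine ⟨hAR, ?_⟩
    obtain ⟨y, hy⟩ := exists_dual hB (fun j => if j = i then (0 : ℝ) else -ε)
    have hyle : ∀ j, ⟪B j, y⟫ ≤ (0 : ℝ) := by
      intro j
      rw [hy]
      split_ifs <;> linarith
    have hygt : (-1 : ℝ) < ⟪αh, y⟫ := by
      have h1 : ⟪αh, p - y⟫ ≤ (0 : ℝ) := (highest_pos hΦ h).inner_nonpos (fun j => by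
        rw [inner_sub_right, hy, hpdef, real_inner_smul_right, hx0]
        split_ifs <;> linarith)
      rw [inner_sub_right] at h1
      have := hp.gt
      linarith
    refine sep_simple hΦ hB h hp ⟨hyle, hygt.le⟩ hAR (by simpa using hp.lt i) ?_ ?_
    · rw [affRefl_apply, hy]
      simp
    · intro β hβ hpos k hk
      left
      have h1 := hpos.inner_nonpos hyle
      have h2 := highest_le h hβ hyle
      rw [hk] at h1 h2
      have h3 : (-1 : ℝ) < k := by linarith
      have h4 : (-1 : ℤ) < k := by exact_mod_cast h3
      have h5 : k ≤ 0 := by exact_mod_cast h1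
      have h6 : k = 0 := by omega
      subst h6
      obtain ⟨c, hc, hβc⟩ := hpos
      rw [hβc, inner_comb] at hk
      have hz : ∀ j, j ≠ i → c j = 0 := by
        have hnn : ∀ j ∈ Finset.univ, c j * ⟪B j, y⟫ ≤ (0 : ℝ) := fun j _ =>
          mul_nonpos_of_nonneg_of_nonpos (hc j) (hyle j)
        have hall := (Finset.sum_eq_zero_iff_of_nonpos hnn).1 (by simpa using hk)
        intro j hj
        have := hall j (Finset.mem_univ j)
        rw [hy, if_neg hj] at this
        rcases mul_eq_zero.1 this with h7 | h7
        · exact h7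
        · linarith
      have hβi : β = c i • B i := by
        rw [hβc]
        apply Finset.sum_eq_single i
        · intro j _ hj
          rw [hz j hj, zero_smul]
        · simp
      have hci : c i = 1 := by
        rcases hΦ.reduced (B i) (hB.mem i) (c i) (hβi ▸ hβ) with h7 | h7
        · exact h7
        · have := hc i
          linarith
      rw [hβi, hci, one_smul]
  have simple0 : affAR Φ (fun x => ⟪-αh, x⟫ - ((1 : ℤ) : ℝ)) (affRefl (-αh) 1) ∧
      sepSet (affAR Φ) p (affRefl (-αh) 1 p) = {fun x => ⟪-αh, x⟫ - ((1 : ℤ) : ℝ)} := by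
    have hAR : affAR Φ (fun x => ⟪-αh, x⟫ - ((1 : ℤ) : ℝ)) (affRefl (-αh) 1) :=
      ⟨-αh, hΦ.neg_mem h.1, 1, rfl, rfl⟩
    refine ⟨hAR, ?_⟩
    have hylt : ∀ j, ⟪B j, H⁻¹ • x0⟫ < (0 : ℝ) := by
      intro j
      rw [real_inner_smul_right, hx0]
      have : 0 < H⁻¹ := by positivity
      linarith
    have hyh : ⟪αh, H⁻¹ • x0⟫ = (-1 : ℝ) := by
      rw [real_inner_smul_right, show ⟪αh, x0⟫ = -H by rw [hH]; ring]
      field_simp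
    refine sep_simple hΦ hB h hp ⟨fun j => (hylt j).le, hyh.ge⟩ hAR ?_ ?_ ?_
    · have := hp.gt
      rw [inner_neg_left]
      push_cast
      linarith
    · rw [affRefl_apply, inner_neg_left, hyh]
      simp
    · intro β hβ hpos k hk
      right
      have h1 := hpos.inner_neg (hΦ.ne_zero β hβ) hylt
      have h2 := highest_le h hβ (fun j => (hylt j).le)
      rw [hk] at h1
      rw [hk, hyh] at h2
      have h3 : (-1 : ℤ) ≤ k := by exact_mod_cast h2
      have h4 : k < 0 := by exact_mod_cast h1
      have h5 : k = -1 := by omega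
      subst h5
      have h6 : β = αh := by
        by_contra hne
        have h7 : isPos B (αh - β) := h.2 β hβ
        have h8 := h7.inner_neg (fun h9 => hne (sub_eq_zero.1 h9).symm) hylt
        rw [inner_sub_left, hk, hyh] at h8
        norm_num at h8
      subst h6
      funext x
      rw [inner_neg_left]
      push_cast
      ring
  refine ⟨p, ⟨affAR_conj hΦ, affAR_neg hΦ, affAR_anti hΦ, affAR_invol, affAR_uniq,
    affAR_fin hΦ, alc_off hΦ hB h hp, affAR_perp hΦ, ?_, ?_⟩⟩
  · rintro s (⟨i, rfl⟩ | rfl)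
    · exact ⟨_, simpleB i⟩
    · exact ⟨_, simple0⟩
  · rintro q hq ⟨b, ⟨r, hb⟩, hb1, hb2⟩
    by_contra hcon
    have hqa : inAlc B αh q := by
      constructor
      · intro j
        by_contra hj
        push Not at hj
        exact hcon ⟨_, Or.inl ⟨j, rfl⟩, _, (simpleB j).1, (simpleB j).2,
          ⟨_, (simpleB j).1⟩, by simpa using hp.lt j, by simpa using hj⟩
      · by_contra hj
        push Not at hj
        refine hcon ⟨_, Or.inr rfl, _, simple0.1, simple0.2, ⟨_, simple0.1⟩, ?_, ?_⟩
        · have := hp.gt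
          show ⟪-αh, p⟫ - ((1 : ℤ) : ℝ) < 0
          rw [inner_neg_left]
          push_cast
          linarith
        · show 0 < ⟪-αh, q⟫ - ((1 : ℤ) : ℝ)
          rw [inner_neg_left]
          push_cast
          linarith
    have := alc_nonpos hΦ hB h hp hqa hb hb1
    linarith

/-! ### Linear parts and translations -/

lemma grp_eq (Φ : Set (E m)) : CoxData.grp (affAR Φ) = Waff Φ := by
  unfold CoxData.grp Waff
  congr 1
  ext r
  constructor
  · rintro ⟨a, α, hα, k, -, rfl⟩
    exact ⟨α, hα, k, rfl⟩
  · rintro ⟨α, hα, k, rfl⟩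
    exact ⟨_, α, hα, k, rfl, rfl⟩

lemma refl_linear {Φ : Set (E m)} (hΦ : IsRootSystem Φ) {α : E m} (hα : α ∈ Φ) (k : ℤ) :
    ∃ L : E m ≃ₗ[ℝ] E m, (∀ x y, affRefl α k x - affRefl α k y = L (x - y)) ∧
      (∀ x, ‖L x‖ = ‖x‖) ∧ Set.MapsTo L Φ Φ := by
  let f : E m →ₗ[ℝ] E m :=
    { toFun := fun x => x - ⟪α, x⟫ • coroot α
      map_add' := fun x y => by rw [inner_add_right]; module
      map_smul' := fun c x => by
        rw [real_inner_smul_right, RingHom.id_apply]; module }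
  have hf : ∀ x, f x = x - ⟪α, x⟫ • coroot α := fun x => rfl
  have hinv : Function.Involutive f := by
    intro x
    have := affReflFun_involutive α 0 x
    simpa [affReflFun, hf] using this
  refine ⟨LinearEquiv.ofInvolutive f hinv, ?_, ?_, ?_⟩
  · intro x y
    show _ = f (x - y)
    rw [hf, affRefl_apply, affRefl_apply, inner_sub_right]
    module
  · intro x
    show ‖f x‖ = ‖x‖
    rw [hf, norm_eq_sqrt_real_inner, norm_eq_sqrt_real_inner, inner_refl_self]
  · intro β hβ
    exact hΦ.reflect_mem α hα β hβ

lemma exists_linear {Φ : Set (E m)} (hΦ : IsRootSystem Φ) {w : Equiv.Perm (E m)}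
    (hw : w ∈ Waff Φ) :
    ∃ L : E m ≃ₗ[ℝ] E m, (∀ x y, w x - w y = L (x - y)) ∧
      (∀ x, ‖L x‖ = ‖x‖) ∧ Set.MapsTo L Φ Φ := by
  unfold Waff at hw
  induction hw using Subgroup.closure_induction'' with
  | one => exact ⟨LinearEquiv.refl ℝ _, by simp, by simp, fun x hx => hx⟩
  | mem r hr =>
    obtain ⟨α, hα, k, rfl⟩ := hr
    exact refl_linear hΦ hα k
  | inv_mem r hr =>
    obtain ⟨α, hα, k, rfl⟩ := hr
    have : (affRefl α k)⁻¹ = affRefl α k :=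
      inv_eq_of_mul_eq_one_left (affAR_invol _ _ ⟨α, hα, k, rfl, rfl⟩)
    rw [this]
    exact refl_linear hΦ hα k
  | mul u v _ _ hu hv =>
    obtain ⟨L, h1, h2, h3⟩ := hu
    obtain ⟨M, h4, h5, h6⟩ := hv
    refine ⟨M.trans L, ?_, ?_, ?_⟩
    · intro x y
      rw [Equiv.Perm.mul_apply, Equiv.Perm.mul_apply, h1, h4]
      rfl
    · intro x
      rw [LinearEquiv.trans_apply, h2, h5]
    · intro x hx
      exact h3 (h6 hx)

lemma ncard_trans {Φ : Set (E m)} (hΦ : IsRootSystem Φ) (p u : E m)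
    (hp : ∀ α ∈ Φ, ∀ k : ℤ, ⟪α, p⟫ ≠ (k : ℝ)) (hu : ∀ α ∈ Φ, ∃ n : ℤ, ⟪α, u⟫ = (n : ℝ)) :
    ((sepSet (affAR Φ) p (p + u)).ncard : ℝ) = ∑ α ∈ hΦ.finite.toFinset, max 0 ⟪α, u⟫ := by
  let T : Finset (Σ _ : E m, ℤ) :=
    hΦ.finite.toFinset.sigma (fun α => Finset.Ioc ⌊(⟪α, p⟫ : ℝ)⌋ ⌊(⟪α, p + u⟫ : ℝ)⌋)
  let F : (Σ _ : E m, ℤ) → (E m → ℝ) := fun q => fun x => ⟪q.1, x⟫ - (q.2 : ℝ)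
  have hF : Function.Injective F := by
    rintro ⟨α, k⟩ ⟨β, j⟩ h
    obtain ⟨rfl, rfl⟩ := aff_inj h
    rfl
  have hne : ∀ α ∈ Φ, ∀ k : ℤ, ⟪α, p + u⟫ ≠ (k : ℝ) := by
    intro α hα k hk
    obtain ⟨n, hn⟩ := hu α hα
    apply hp α hα (k - n)
    rw [inner_add_right] at hk
    push_cast
    linarith
  have hset : sepSet (affAR Φ) p (p + u) = F '' (T : Set (Σ _ : E m, ℤ)) := by
    ext a
    constructor
    · rintro ⟨⟨r, α, hα, k, rfl, rfl⟩, h1, h2⟩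
      refine ⟨⟨α, k⟩, ?_, rfl⟩
      rw [Finset.mem_coe, Finset.mem_sigma, Set.Finite.mem_toFinset, Finset.mem_Ioc]
      refine ⟨hα, Int.floor_lt.2 (by linarith), Int.le_floor.2 (by linarith)⟩
    · rintro ⟨⟨α, k⟩, hm, rfl⟩
      rw [Finset.mem_coe, Finset.mem_sigma, Set.Finite.mem_toFinset, Finset.mem_Ioc] at hm
      obtain ⟨hα, h1, h2⟩ := hm
      have h1 := Int.floor_lt.1 h1
      have h2 := Int.le_floor.1 h2
      refine ⟨⟨_, α, hα, k, rfl, rfl⟩, ?_, ?_⟩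
      · show ⟪α, p⟫ - (k : ℝ) < 0
        linarith
      · show 0 < ⟪α, p + u⟫ - (k : ℝ)
        have := lt_of_le_of_ne h2 (Ne.symm (hne α hα k))
        linarith
  rw [hset, Set.ncard_image_of_injective _ hF, Set.ncard_coe_finset, Finset.card_sigma]
  push_cast
  apply Finset.sum_congr rfl
  intro α hα
  rw [Set.Finite.mem_toFinset] at hα
  obtain ⟨n, hn⟩ := hu α hα
  rw [Int.card_Ioc, inner_add_right, hn, Int.floor_add_intCast, add_sub_cancel_left]
  rw [← Int.cast_natCast, Int.toNat_eq_max]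
  push_cast
  exact max_comm _ _

lemma sum_max_refl {Φ : Set (E m)} (hΦ : IsRootSystem Φ) {β : E m} (hβ : β ∈ Φ) (x : E m) :
    ∑ α ∈ hΦ.finite.toFinset, max 0 ⟪α, affRefl β 0 x⟫ =
      ∑ α ∈ hΦ.finite.toFinset, max (0 : ℝ) ⟪α, x⟫ := by
  have hinv : ∀ y : E m, (y - ⟪β, y⟫ • coroot β) -
      ⟪β, y - ⟪β, y⟫ • coroot β⟫ • coroot β = y := by
    intro y
    have := affReflFun_involutive β 0 y
    simpa [affReflFun] using this
  refine Finset.sum_bij' (fun α _ => α - ⟪β, α⟫ • coroot β) (fun α _ => α - ⟪β, α⟫ • coroot β)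
    ?_ ?_ ?_ ?_ ?_
  · intro α hα
    rw [Set.Finite.mem_toFinset] at hα ⊢
    exact hΦ.reflect_mem β hβ α hα
  · intro α hα
    rw [Set.Finite.mem_toFinset] at hα ⊢
    exact hΦ.reflect_mem β hβ α hα
  · intro α _
    exact hinv α
  · intro α _
    exact hinv α
  · intro α _
    rw [inner_refl', affRefl_apply]
    simp

lemma sum_max_inv {Φ : Set (E m)} (hΦ : IsRootSystem Φ) {u : Equiv.Perm (E m)}
    (hu : u ∈ W0 Φ) : ∀ x : E m,
    ∑ α ∈ hΦ.finite.toFinset, max (0 : ℝ) ⟪α, u x⟫ =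
      ∑ α ∈ hΦ.finite.toFinset, max (0 : ℝ) ⟪α, x⟫ := by
  unfold W0 at hu
  induction hu using Subgroup.closure_induction'' with
  | one => intro x; rfl
  | mem r hr =>
    obtain ⟨α, hα, rfl⟩ := hr
    exact sum_max_refl hΦ hα
  | inv_mem r hr =>
    obtain ⟨α, hα, rfl⟩ := hr
    have : (affRefl α 0)⁻¹ = affRefl α 0 :=
      inv_eq_of_mul_eq_one_left (affAR_invol _ _ ⟨α, hα, 0, rfl, rfl⟩)
    rw [this]
    exact sum_max_refl hΦ hα
  | mul u v _ _ hu hv =>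
    intro x
    rw [Equiv.Perm.mul_apply, hu, hv]

lemma sum_max_dom {Φ : Set (E m)} (hΦ : IsRootSystem Φ) {B : Fin m → E m}
    (hB : IsSimpleSystem Φ B) (P : Finset (E m)) (hP : IsPositiveSystem Φ B P) (x : E m)
    (hx : ∀ j, 0 ≤ ⟪B j, x⟫) :
    ∑ α ∈ hΦ.finite.toFinset, max (0 : ℝ) ⟪α, x⟫ = ⟪∑ α ∈ P, α, x⟫ := by
  have hmem : ∀ α, α ∈ P ↔ α ∈ Φ ∧ isPos B α := by
    intro α
    rw [← Finset.mem_coe, hP]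
    rfl
  have hnn : ∀ α, isPos B α → (0 : ℝ) ≤ ⟪α, x⟫ := by
    intro α hα
    have := hα.inner_nonpos (x := -x) (fun j => by rw [inner_neg_right]; linarith [hx j])
    rw [inner_neg_right] at this
    linarith
  rw [sum_inner]
  have hsub : P ⊆ hΦ.finite.toFinset := by
    intro α hα
    rw [Set.Finite.mem_toFinset]
    exact ((hmem α).1 hα).1
  rw [← Finset.sum_subset hsub]
  · apply Finset.sum_congr rfl
    intro α hα
    exact max_eq_right (hnn α ((hmem α).1 hα).2)
  · intro α hα hnot
    rw [Set.Finite.mem_toFinset] at hα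
    rcases isPos_or hB hα with h1 | h1
    · exact absurd ((hmem α).2 ⟨hα, h1⟩) hnot
    · have := hnn _ h1
      rw [inner_neg_left] at this
      exact max_eq_left (by linarith)

/-- An element `w ∈ W^aff` (with translation vector `v_w`, and `ṽ_w` the
representative of the `W`-orbit of `v_w` in the closed fundamental Weyl chamber) is straight
if and only if it admits a word expression of length `⟨2ρ, ṽ_w⟩`; in that case
`ℓ(w) = ⟨2ρ, ṽ_w⟩`. -/
theorem straight_iff_word_length {m : ℕ} (Φ : Set (E m)) (hΦ : IsRootSystem Φ)
    (B : Fin m → E m) (hB : IsSimpleSystem Φ B)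
    (αh : E m) (hαh : IsHighestRoot Φ B αh)
    (P : Finset (E m)) (hP : IsPositiveSystem Φ B P)
    (ρ2 : E m) (hρ2 : ρ2 = ∑ α ∈ P, α)
    (w : Equiv.Perm (E m)) (hw : w ∈ Waff Φ)
    (hmne : (minSet (w : E m → E m)).Nonempty)
    (v : E m) (hv : HasTransVec (w : E m → E m) v)
    (vt : E m) (hvt_orbit : ∃ u ∈ W0 Φ, (u : Equiv.Perm (E m)) v = vt)
    (hvt_dominant : ∀ j, 0 ≤ ⟪B j, vt⟫) :
    (IsStraight (SAff B αh) w ↔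
      ∃ l : List (Equiv.Perm (E m)), (∀ g ∈ l, g ∈ SAff B αh) ∧ l.prod = w ∧
        (l.length : ℝ) = ⟪ρ2, vt⟫) ∧
    (IsStraight (SAff B αh) w → ((len (SAff B αh) w : ℝ) = ⟪ρ2, vt⟫)) := by
  subst hρ2
  obtain ⟨p, hcox⟩ := exists_coxData hΦ hB hαh
  have hgrp : CoxData.grp (affAR Φ) = Waff Φ := grp_eq Φ
  obtain ⟨Lw, hLw, hLn, hLΦ⟩ := exists_linear hΦ hw
  obtain ⟨x0, hx0⟩ := hmne
  have hiso : ∀ x y, dist (w x) (w y) = dist x y := by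
    intro x y
    rw [dist_eq_norm, dist_eq_norm, hLw, hLn]
  have hpow : ∀ n : ℕ, (w ^ n) x0 ∈ minSet (w : E m → E m) ∧ (w ^ n) x0 = x0 + (n : ℝ) • v := by
    intro n
    induction n with
    | zero => simpa using hx0
    | succ n ih =>
      obtain ⟨h1, h2⟩ := ih
      rw [pow_succ', Equiv.Perm.mul_apply]
      refine ⟨?_, ?_⟩
      · have h3 : dist _ _ = _ := h1
        show dist _ _ = _
        rw [hiso]
        exact h3
      · rw [hv _ h1, h2]
        push_cast
        module
  have hLpow : ∀ (n : ℕ) x y, (w ^ n) x - (w ^ n) y = (Lw ^ n) (x - y) := by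
    intro n
    induction n with
    | zero => intro x y; simp
    | succ n ih =>
      intro x y
      rw [pow_succ', pow_succ', Equiv.Perm.mul_apply, Equiv.Perm.mul_apply, hLw, ih]
      rfl
  obtain ⟨k, hk, hLk⟩ := isOfFinOrder_iff_pow_eq_one.1
    (LinearEquiv.isOfFinOrder_of_finite_of_span_eq_top_of_mapsTo hΦ.finite hΦ.span_eq_top hLΦ)
  have htrans : ∀ (n : ℕ) y, (w ^ (k * n)) y = y + ((k * n : ℕ) : ℝ) • v := by
    intro n y
    have h1 := hLpow (k * n) y x0
    rw [pow_mul Lw, hLk, one_pow, (hpow (k * n)).2] at h1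
    have h2 : (w ^ (k * n)) y = (x0 + ((k * n : ℕ) : ℝ) • v) + (y - x0) := by
      rw [sub_eq_iff_eq_add] at h1
      rw [h1, add_comm]
      rfl
    rw [h2]
    abel
  have hw' : w ∈ CoxData.grp (affAR Φ) := hgrp ▸ hw
  refine hcox.straight_iff hw' _ k hk ?_
  intro n
  rw [hcox.len_eq (pow_mem hw' _), htrans, ncard_trans hΦ p _ ?_ ?_]
  · obtain ⟨u, hu, huv⟩ := hvt_orbit
    have h1 : ∀ α : E m, max 0 ⟪α, ((k * n : ℕ) : ℝ) • v⟫ =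
        ((k * n : ℕ) : ℝ) * max 0 ⟪α, v⟫ := by
      intro α
      rw [real_inner_smul_right, mul_max_of_nonneg _ _ (Nat.cast_nonneg _), mul_zero]
    simp only [h1]
    rw [← Finset.mul_sum, ← sum_max_inv hΦ hu, huv, sum_max_dom hΦ hB P hP vt hvt_dominant]
    push_cast
    ring
  · intro α hα j hj
    exact hcox.off _ _ ⟨α, hα, j, rfl, rfl⟩ (sub_eq_zero.2 hj)
  · intro α hα
    obtain ⟨r, β, hβ, j, hj, -⟩ := hcox.comp_grp (pow_mem hw' (k * n))
      (fun x => ⟪α, x⟫ - ((0 : ℤ) : ℝ)) ⟨_, α, hα, 0, rfl, rfl⟩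
    refine ⟨-j, ?_⟩
    have := congrFun hj 0
    simp only [htrans, zero_add, inner_zero_right, Int.cast_zero] at this
    rw [Int.cast_neg]
    linarith

end
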